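/- Let A be a commonly graded algebra with graded Jacobson radical J and S = A/J. If J/J^2 is finite-dimensional over k, then A is finitely generated as a k-algebra. -/

import Mathlib

open DirectSum

variable (k : Type) [Field k] (A : Type) [Ring A] [Algebra k A]

/-- A `ℤ`-graded algebra is *commonly graded* if it is locally finite and bounded below. -/
def CommonlyGraded (𝒜 : ℤ → Submodule k A) : Prop :=
  (∀ i : ℤ, FiniteDimensional k (𝒜 i)) ∧ ∃ b : ℤ, ∀ i : ℤ, i < b → 𝒜 i = ⊥

/-- A maximal graded left ideal: a homogeneous proper left ideal which is maximal among
homogeneous proper left ideals. -/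
def IsMaxGradedLeftIdeal (𝒜 : ℤ → Submodule k A) [GradedRing 𝒜] (L : Ideal A) : Prop :=
  Ideal.IsHomogeneous 𝒜 L ∧ L ≠ ⊤ ∧
    ∀ I : Ideal A, Ideal.IsHomogeneous 𝒜 I → I ≠ ⊤ → L ≤ I → I = L

/-- The graded Jacobson radical: the intersection of all maximal graded left ideals. -/
noncomputable def grJacobson (𝒜 : ℤ → Submodule k A) [GradedRing 𝒜] : Ideal A :=
  sInf {L : Ideal A | IsMaxGradedLeftIdeal k A 𝒜 L}

/-- The graded Jacobson radical viewed as a `k`-subspace of `A`. -/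
noncomputable def grJacobsonK (𝒜 : ℤ → Submodule k A) [GradedRing 𝒜] : Submodule k A :=
  Submodule.restrictScalars k (grJacobson k A 𝒜)

/-- `A_{≥ i}`, the sum of the homogeneous components of degree at least `i`. -/
def AgeSub (𝒜 : ℤ → Submodule k A) (i : ℤ) : Submodule k A :=
  ⨆ j : ℤ, ⨆ _ : i ≤ j, 𝒜 j

theorem gr_comp_mul_right (𝒜 : ℤ → Submodule k A) [GradedRing 𝒜] {a x : A} {d : ℤ} (hx : x ∈ 𝒜 d)
    (e : ℤ) : (decompose 𝒜 (a * x) e : A) = (decompose 𝒜 a (e - d) : A) * x := by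
  have := coe_decompose_mul_add_of_right_mem 𝒜 (a := a) (i := e - d) hx
  rwa [sub_add_cancel] at this

/-- the image of a homogeneous left ideal under right multiplication by a homogeneous element -/
theorem homog_map (𝒜 : ℤ → Submodule k A) [GradedRing 𝒜] {x : A} {d : ℤ} (hx : x ∈ 𝒜 d)
    (I : Ideal A) (hI : Ideal.IsHomogeneous 𝒜 I) :
    Ideal.IsHomogeneous 𝒜 (Submodule.map (LinearMap.toSpanSingleton A A x) I) := by
  rintro e y ⟨i, hi, rfl⟩
  refine ⟨(decompose 𝒜 i (e - d) : A), hI _ hi, ?_⟩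
  simp only [LinearMap.toSpanSingleton_apply, smul_eq_mul]
  rw [gr_comp_mul_right k A 𝒜 hx]

theorem homog_comap (𝒜 : ℤ → Submodule k A) [GradedRing 𝒜] {x : A} {d : ℤ} (hx : x ∈ 𝒜 d)
    (I : Ideal A) (hI : Ideal.IsHomogeneous 𝒜 I) :
    Ideal.IsHomogeneous 𝒜 (Submodule.comap (LinearMap.toSpanSingleton A A x) I) := by
  intro e y hy
  simp only [Submodule.mem_comap, LinearMap.toSpanSingleton_apply,
    smul_eq_mul] at hy ⊢
  have := hI (e + d) hy
  rw [gr_comp_mul_right k A 𝒜 hx, add_sub_cancel_right] at this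
  exact this

/-- If `K / L` is graded simple then `J K ⊆ L`. -/
theorem mul_mem_of_simple (𝒜 : ℤ → Submodule k A) [GradedRing 𝒜] (K L : Ideal A)
    (hK : Ideal.IsHomogeneous 𝒜 K) (hL : Ideal.IsHomogeneous 𝒜 L)
    (hLK : L ≤ K)
    (hmax : ∀ I : Ideal A, Ideal.IsHomogeneous 𝒜 I → L ≤ I → I ≤ K → I ≠ K → I = L)
    (j : A) (hj : j ∈ grJacobson k A 𝒜) (x : A) (hx : x ∈ K) : j * x ∈ L := by
  classical
  have key : ∀ d : ℤ, ∀ x ∈ 𝒜 d, x ∈ K → j * x ∈ L := by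
    intro d x hxd hxK
    by_cases hxL : x ∈ L
    · exact L.mul_mem_left _ hxL
    have hmaxc : IsMaxGradedLeftIdeal k A 𝒜
        (Submodule.comap (LinearMap.toSpanSingleton A A x) L) := by
      refine ⟨homog_comap k A 𝒜 hxd L hL, ?_, ?_⟩
      · intro h
        have h1 : (1 : A) ∈ Submodule.comap (LinearMap.toSpanSingleton A A x) L := by
          rw [h]; trivial
        simp at h1
        exact hxL h1
      · intro I hI hItop hle
        refine le_antisymm ?_ hle
        have hM := hmax (Submodule.map (LinearMap.toSpanSingleton A A x) I ⊔ L)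
          (Ideal.IsHomogeneous.sup (homog_map k A 𝒜 hxd I hI) hL) le_sup_right
          (sup_le (by
            rintro _ ⟨i, _, rfl⟩
            simpa using K.mul_mem_left i hxK) hLK)
        by_cases hMK : Submodule.map (LinearMap.toSpanSingleton A A x) I ⊔ L = K
        · exfalso
          rw [← hMK] at hxK
          obtain ⟨y, ⟨i, hi, rfl⟩, l, hl, hyl⟩ := Submodule.mem_sup.1 hxK
          apply hItop
          rw [Ideal.eq_top_iff_one]
          have h1 : (1 - i) ∈ Submodule.comap (LinearMap.toSpanSingleton A A x) L := by
            simp only [Submodule.mem_comap, LinearMap.toSpanSingleton_apply, smul_eq_mul, sub_mul,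
              one_mul]
            simp only [LinearMap.toSpanSingleton_apply, smul_eq_mul] at hyl
            have : x - i * x = l := by
              rw [sub_eq_iff_eq_add, add_comm]; exact hyl.symm
            rwa [this]
          have := I.add_mem (hle h1) hi
          simpa using this
        · have := hM hMK
          rw [← Submodule.map_le_iff_le_comap, ← this]
          exact le_sup_left
    have := (Submodule.mem_sInf.1 hj) _ hmaxc
    simpa using this
  rw [← DirectSum.sum_support_decompose 𝒜 x, Finset.mul_sum]
  exact Submodule.sum_mem _ fun i _ => key i _ (SetLike.coe_mem _) (hK i hx)

/-- If `N ≤ K` are homogeneous left ideals, `N` of finite codimension, then `J^n K ⊆ N`. -/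
theorem pow_mul_le (𝒜 : ℤ → Submodule k A) [GradedRing 𝒜] (N : Ideal A)
    [IsNoetherian A (A ⧸ N)] [IsArtinian A (A ⧸ N)] (hN : Ideal.IsHomogeneous 𝒜 N) :
    ∀ K : Ideal A, Ideal.IsHomogeneous 𝒜 K → N ≤ K →
      ∃ n : ℕ, (grJacobsonK k A 𝒜) ^ n * K.restrictScalars k ≤ N.restrictScalars k := by
  have main : ∀ (Q : Submodule A (A ⧸ N)), ∀ K : Ideal A, K = Q.comap N.mkQ →
      Ideal.IsHomogeneous 𝒜 K →
      ∃ n : ℕ, (grJacobsonK k A 𝒜) ^ n * K.restrictScalars k ≤ N.restrictScalars k := by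
    intro Q
    induction Q using WellFoundedLT.induction with
    | ind Q ih =>
    intro K hKQ hK
    have hNK : N ≤ K := by
      rw [hKQ]; intro x hx; simp [(Submodule.Quotient.mk_eq_zero N).2 hx]
    by_cases hEq : N = K
    · exact ⟨0, by simp [hEq]⟩
    let S : Set (Submodule A (A ⧸ N)) :=
      {P | Ideal.IsHomogeneous 𝒜 (P.comap N.mkQ) ∧ P < Q}
    have hS : S.Nonempty := by
      refine ⟨⊥, ?_, ?_⟩
      · have : Submodule.comap N.mkQ ⊥ = N := by
          change LinearMap.ker N.mkQ = N
          simp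
        rw [this]; exact hN
      · rw [bot_lt_iff_ne_bot]
        rintro rfl
        apply hEq
        rw [hKQ]
        change N = LinearMap.ker N.mkQ
        simp
    obtain ⟨P, ⟨hP1, hP2⟩, hP3⟩ := WellFounded.has_min
      (wellFounded_gt : WellFounded ((· > ·) : Submodule A (A ⧸ N) → _ → Prop)) S hS
    obtain ⟨n, hn⟩ := ih P hP2 _ rfl hP1
    refine ⟨n + 1, ?_⟩
    rw [pow_succ, mul_assoc]
    refine le_trans (mul_le_mul' le_rfl ?_) hn
    rw [Submodule.mul_le]
    intro j hj x hx
    refine mul_mem_of_simple k A 𝒜 K _ hK hP1 ?_ ?_ j hj x hx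
    · rw [hKQ]; exact Submodule.comap_mono hP2.le
    · intro I hI hPI hIK hne
      have hNI : N ≤ I := le_trans (by
        intro x hx; simp [(Submodule.Quotient.mk_eq_zero N).2 hx]) hPI
      have hcm : Submodule.comap N.mkQ (Submodule.map N.mkQ I) = I := by
        rw [Submodule.comap_map_eq]; simpa using hNI
      have hIQ : Submodule.map N.mkQ I ≤ Q := by
        rw [Submodule.map_le_iff_le_comap, ← hKQ]; exact hIK
      have hPI' : P ≤ Submodule.map N.mkQ I := by
        have := Submodule.map_mono (f := N.mkQ) hPI
        rwa [Submodule.map_comap_eq_of_surjective (Submodule.mkQ_surjective N)] at this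
      by_cases hlt : Submodule.map N.mkQ I = Q
      · exact absurd (by rw [← hcm, hlt, hKQ]) hne
      · have hmem : Submodule.map N.mkQ I ∈ S := ⟨by rw [hcm]; exact hI, lt_of_le_of_ne hIQ hlt⟩
        have h2 := hP3 _ hmem
        have : Submodule.map N.mkQ I = P := by
          by_contra h
          exact h2 (lt_of_le_of_ne hPI' (Ne.symm h))
        rw [← this, hcm]
  intro K hK hNK
  refine main (Submodule.map N.mkQ K) K ?_ hK
  rw [Submodule.comap_map_eq]; simpa using hNK

/-- High powers of `J` live in high degrees. -/
theorem pow_high (𝒜 : ℤ → Submodule k A) [GradedRing 𝒜] (hA : CommonlyGraded k A 𝒜) (i : ℤ) :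
    ∃ n : ℕ, ∀ x ∈ (grJacobsonK k A 𝒜) ^ (n + 1), (decompose 𝒜 x i : A) = 0 := by
  classical
  obtain ⟨hfin, b, hb⟩ := hA
  set t : ℤ := i + 1 - b with ht
  let N : Ideal A := Ideal.span {x | ∃ j, t ≤ j ∧ x ∈ 𝒜 j}
  have hN : Ideal.IsHomogeneous 𝒜 N :=
    Ideal.homogeneous_span 𝒜 _ (by rintro x ⟨j, _, hj⟩; exact ⟨j, hj⟩)
  have hNi' : ∀ x ∈ N, ∀ a : A, (decompose 𝒜 (a * x) i : A) = 0 := by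
    intro x hx
    induction hx using Submodule.span_induction with
    | mem x h =>
      obtain ⟨j, hj, hx⟩ := h
      intro a
      rw [gr_comp_mul_right k A 𝒜 hx]
      have h0 : (decompose 𝒜 a (i - j) : A) = 0 :=
        (Submodule.mem_bot k).1 ((hb (i - j) (by omega)) ▸ SetLike.coe_mem (decompose 𝒜 a (i - j)))
      rw [h0, zero_mul]
    | zero => simp
    | add x y _ _ hx hy => intro a; rw [mul_add, decompose_add, DirectSum.add_apply, Submodule.coe_add, hx a, hy a, add_zero]
    | smul r x _ hx => intro a; rw [smul_eq_mul, ← mul_assoc]; exact hx _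
  have hNi : ∀ x ∈ N, (decompose 𝒜 x i : A) = 0 := fun x hx => by
    simpa using hNi' x hx 1
  let W : Submodule k A := ⨆ j ∈ Finset.Ico b t, 𝒜 j
  have hW : FiniteDimensional k W := by
    have := Submodule.finiteDimensional_finset_sup (Finset.Ico b t) 𝒜
    rwa [Finset.sup_eq_iSup] at this
  have hfd : Module.Finite k (A ⧸ N) := by
    let f : W →ₗ[k] (A ⧸ N) := (N.mkQ.restrictScalars k).comp W.subtype
    refine Module.Finite.of_surjective f ?_
    intro q
    obtain ⟨x, rfl⟩ := Submodule.mkQ_surjective N q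
    have hx : ∀ x : A, N.mkQ x ∈ LinearMap.range f := by
      intro x
      rw [← DirectSum.sum_support_decompose 𝒜 x, map_sum]
      refine Submodule.sum_mem _ fun j _ => ?_
      by_cases h1 : t ≤ j
      · have : (decompose 𝒜 x j : A) ∈ N := Ideal.subset_span ⟨j, h1, SetLike.coe_mem _⟩
        rw [Submodule.mkQ_apply, (Submodule.Quotient.mk_eq_zero N).2 this]
        exact Submodule.zero_mem _
      · by_cases h2 : j < b
        · have h0 : (decompose 𝒜 x j : A) = 0 :=
            (Submodule.mem_bot k).1 ((hb j h2) ▸ SetLike.coe_mem (decompose 𝒜 x j))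
          rw [h0, map_zero]
          exact Submodule.zero_mem _
        · have hm : (decompose 𝒜 x j : A) ∈ W := by
            have hj : j ∈ Finset.Ico b t := by simp; omega
            exact (le_iSup₂ (f := fun j (_ : j ∈ Finset.Ico b t) => 𝒜 j) j hj) (SetLike.coe_mem _)
          exact ⟨⟨_, hm⟩, rfl⟩
    exact hx x
  have : IsNoetherian A (A ⧸ N) := isNoetherian_of_tower k inferInstance
  have : IsArtinian A (A ⧸ N) := isArtinian_of_tower k inferInstance
  obtain ⟨n, hn⟩ := pow_mul_le k A 𝒜 N hN ⊤ (Ideal.IsHomogeneous.top 𝒜) le_top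
  refine ⟨n, fun x hx => hNi x (hn ?_)⟩
  rw [pow_succ] at hx
  have hle : grJacobsonK k A 𝒜 ≤ Submodule.restrictScalars k (⊤ : Ideal A) :=
    fun _ _ => trivial
  exact (mul_le_mul' le_rfl hle :
    (grJacobsonK k A 𝒜) ^ n * grJacobsonK k A 𝒜 ≤ _) hx

theorem high_mem_J (𝒜 : ℤ → Submodule k A) [GradedRing 𝒜] (b : ℤ)
    (hb : ∀ i : ℤ, i < b → 𝒜 i = ⊥) (m : ℤ) (hm : -b < m) (x : A) (hx : x ∈ 𝒜 m) :
    x ∈ grJacobsonK k A 𝒜 := by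
  change x ∈ grJacobson k A 𝒜
  rw [grJacobson, Submodule.mem_sInf]
  rintro L ⟨hL, hLtop, hmax⟩
  by_contra hxL
  have htop : Submodule.map (LinearMap.toSpanSingleton A A x) ⊤ ⊔ L = ⊤ := by
    by_contra h
    have := hmax _ (Ideal.IsHomogeneous.sup (homog_map k A 𝒜 hx ⊤ (Ideal.IsHomogeneous.top 𝒜)) hL)
      h le_sup_right
    apply hxL
    rw [← this]
    exact Submodule.mem_sup_left ⟨1, trivial, by simp⟩
  have h1 : (1 : A) ∈ Submodule.map (LinearMap.toSpanSingleton A A x) ⊤ ⊔ L := by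
    rw [htop]; trivial
  obtain ⟨y, ⟨a, _, rfl⟩, l, hl, hyl⟩ := Submodule.mem_sup.1 h1
  simp only [LinearMap.toSpanSingleton_apply, smul_eq_mul] at hyl
  apply hLtop
  rw [Ideal.eq_top_iff_one]
  have h2 : (decompose 𝒜 (1 : A) 0 : A) = 1 := decompose_of_mem_same 𝒜 SetLike.GradedOne.one_mem
  have h0 : (decompose 𝒜 a (0 - m) : A) = 0 :=
    (Submodule.mem_bot k).1 ((hb (0 - m) (by omega)) ▸ SetLike.coe_mem (decompose 𝒜 a (0 - m)))
  rw [← h2, ← hyl, decompose_add, DirectSum.add_apply, Submodule.coe_add,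
    gr_comp_mul_right k A 𝒜 hx, h0, zero_mul, zero_add]
  exact hL 0 hl

theorem pow_le_sup (J V : Submodule k A) (hV : V ≤ J) (hJ : J ≤ V ⊔ J * J) (n : ℕ) :
    J ^ (n + 1) ≤ V ^ (n + 1) ⊔ J ^ (n + 2) := by
  induction n with
  | zero => simpa [pow_two] using hJ
  | succ n ih =>
    calc J ^ (n + 1 + 1) = J ^ (n + 1) * J := pow_succ _ _
      _ ≤ J ^ (n + 1) * (V ⊔ J * J) := mul_le_mul' le_rfl hJ
      _ = J ^ (n + 1) * V ⊔ J ^ (n + 1) * (J * J) := Submodule.mul_sup _ _ _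
      _ ≤ V ^ (n + 1 + 1) ⊔ J ^ (n + 1 + 2) := by
        refine sup_le ?_ ?_
        · refine (mul_le_mul' ih le_rfl).trans ?_
          rw [Submodule.sup_mul, ← pow_succ]
          refine sup_le_sup le_rfl ?_
          rw [show n + 1 + 2 = (n + 2) + 1 from rfl, pow_succ J (n + 2)]
          exact mul_le_mul' le_rfl hV
        · rw [← pow_two, ← pow_add]
          exact le_sup_right

theorem le_sup_pow (J V : Submodule k A) (B : Subalgebra k A) (hV : V ≤ J)
    (hJ : J ≤ V ⊔ J * J) (hVB : V ≤ Subalgebra.toSubmodule B) (n : ℕ) :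
    J ≤ Subalgebra.toSubmodule B ⊔ J ^ (n + 1) := by
  induction n with
  | zero => simp
  | succ n ih =>
    refine ih.trans (sup_le le_sup_left ((pow_le_sup k A J V hV hJ n).trans
      (sup_le_sup ?_ le_rfl)))
    have : ∀ m : ℕ, V ^ m ≤ Subalgebra.toSubmodule B := by
      intro m
      induction m with
      | zero => rw [pow_zero, Submodule.one_le]; exact B.one_mem
      | succ m ih =>
        rw [pow_succ, Submodule.mul_le]
        intro x hx y hy
        exact B.mul_mem (ih hx) (hVB hy)
    exact this _

theorem adjoin_homog (𝒜 : ℤ → Submodule k A) [GradedRing 𝒜] (s : Set A)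
    (hs : ∀ x ∈ s, ∃ i, x ∈ 𝒜 i) (x : A) (hx : x ∈ Algebra.adjoin k s) (i : ℤ) :
    (decompose 𝒜 x i : A) ∈ Algebra.adjoin k s := by
  have hm : ∀ y ∈ Submonoid.closure s, ∃ i, y ∈ 𝒜 i := by
    intro y hy
    induction hy using Submonoid.closure_induction with
    | mem y h => exact hs y h
    | one => exact ⟨0, SetLike.GradedOne.one_mem⟩
    | mul y z _ _ hy hz =>
      obtain ⟨i, hi⟩ := hy
      obtain ⟨j, hj⟩ := hz
      exact ⟨i + j, SetLike.GradedMul.mul_mem hi hj⟩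
  rw [← Subalgebra.mem_toSubmodule, Algebra.adjoin_eq_span] at hx
  induction hx using Submodule.span_induction with
  | mem y h =>
    obtain ⟨j, hj⟩ := hm y h
    by_cases hij : j = i
    · subst hij
      rw [decompose_of_mem_same 𝒜 hj, ← Subalgebra.mem_toSubmodule, Algebra.adjoin_eq_span]
      exact Submodule.subset_span h
    · rw [decompose_of_mem_ne 𝒜 hj hij]; exact Subalgebra.zero_mem _
  | zero => simp
  | add y z _ _ hy hz => simpa using Subalgebra.add_mem _ hy hz
  | smul r y _ hy =>
    rw [decompose_smul]
    exact Subalgebra.smul_mem _ hy r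

/-- If `J/J²` is finite-dimensional over `k`, then `A` is a finitely generated
`k`-algebra. -/
theorem stmt_5 (𝒜 : ℤ → Submodule k A) [GradedRing 𝒜] (hA : CommonlyGraded k A 𝒜)
    (hJ : FiniteDimensional k
      (↥(grJacobsonK k A 𝒜) ⧸
        Submodule.comap (grJacobsonK k A 𝒜).subtype
          (grJacobsonK k A 𝒜 * grJacobsonK k A 𝒜))) :
    ∃ s : Finset A, Algebra.adjoin k (s : Set A) = ⊤ := by
  classical
  set J := grJacobsonK k A 𝒜 with hJdef
  obtain ⟨n, f, hf⟩ := Module.Finite.exists_fin (R := k)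
    (M := ↥J ⧸ Submodule.comap J.subtype (J * J))
  choose g hg using fun i => Submodule.mkQ_surjective (Submodule.comap J.subtype (J * J)) (f i)
  let V : Submodule k A := Submodule.span k (Set.range fun i => (g i : A))
  have hVJ : V ≤ J := by
    rw [Submodule.span_le]
    rintro _ ⟨i, rfl⟩
    exact (g i).2
  have hJV : J ≤ V ⊔ J * J := by
    intro x hx
    have hq : (Submodule.comap J.subtype (J * J)).mkQ ⟨x, hx⟩ ∈
        Submodule.span k (Set.range f) := by rw [hf]; trivial
    have hr : Set.range f = (Submodule.comap J.subtype (J * J)).mkQ '' (Set.range g) := by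
      rw [← Set.range_comp]; congr 1; funext i; exact (hg i).symm
    rw [hr, ← Submodule.map_span] at hq
    obtain ⟨y, hy, hyx⟩ := hq
    have hsub : (⟨x, hx⟩ : J) - y ∈ Submodule.comap J.subtype (J * J) :=
      (Submodule.Quotient.eq _).1 hyx.symm
    have hyV : (y : A) ∈ V := by
      have := Submodule.mem_map_of_mem (f := J.subtype) hy
      rw [Submodule.map_span, ← Set.range_comp] at this
      exact this
    have hs2 : x - (y : A) ∈ J * J := hsub
    exact Submodule.mem_sup.2 ⟨y, hyV, x - y, hs2, by abel⟩
  have hA' := hA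
  obtain ⟨hfin, b, hb⟩ := hA'
  let I : Finset ℤ := Finset.Icc b (-b) ∪
    Finset.univ.biUnion fun i => (decompose 𝒜 (g i : A)).support
  choose T hT using fun i => (Submodule.fg_iff_finiteDimensional (𝒜 i)).2 (hfin i)
  let s : Finset A := I.biUnion T
  refine ⟨s, ?_⟩
  set B := Algebra.adjoin k (s : Set A) with hB
  have hIB : ∀ i ∈ I, 𝒜 i ≤ Subalgebra.toSubmodule B := by
    intro i hi
    rw [← hT i, Submodule.span_le]
    intro x hx
    exact Algebra.subset_adjoin (Finset.mem_coe.2 (Finset.mem_biUnion.2 ⟨i, hi, hx⟩))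
  have hs : ∀ x ∈ (s : Set A), ∃ i, x ∈ 𝒜 i := by
    intro x hx
    obtain ⟨i, _, hx⟩ := Finset.mem_biUnion.1 (Finset.mem_coe.1 hx)
    refine ⟨i, ?_⟩
    rw [← hT i]
    exact Submodule.subset_span hx
  have hVB : V ≤ Subalgebra.toSubmodule B := by
    rw [Submodule.span_le]
    rintro _ ⟨i, rfl⟩
    change (g i : A) ∈ Subalgebra.toSubmodule B
    rw [← DirectSum.sum_support_decompose 𝒜 (g i : A)]
    refine Submodule.sum_mem _ fun j hj => hIB j ?_ (SetLike.coe_mem _)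
    exact Finset.mem_union_right _ (Finset.mem_biUnion.2 ⟨i, Finset.mem_univ _, hj⟩)
  have hhom : ∀ m : ℤ, ∀ x ∈ 𝒜 m, x ∈ B := by
    intro m x hx
    by_cases h1 : m < b
    · rw [hb m h1, Submodule.mem_bot] at hx
      rw [hx]; exact B.zero_mem
    by_cases h2 : m ≤ -b
    · refine hIB m (Finset.mem_union_left _ ?_) hx
      simp; omega
    have hxJ : x ∈ J := high_mem_J k A 𝒜 b hb m (by omega) x hx
    obtain ⟨n, hn⟩ := pow_high k A 𝒜 hA m
    obtain ⟨c, hc, y, hy, hcy⟩ := Submodule.mem_sup.1 (le_sup_pow k A J V B hVJ hJV hVB n hxJ)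
    rw [← decompose_of_mem_same 𝒜 hx, ← hcy, decompose_add, DirectSum.add_apply,
      Submodule.coe_add, hn y hy, add_zero]
    exact adjoin_homog k A 𝒜 s hs c hc m
  rw [eq_top_iff]
  intro x _
  rw [← DirectSum.sum_support_decompose 𝒜 x]
  exact Subalgebra.sum_mem _ fun i _ => hhom i _ (SetLike.coe_mem _)
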